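/- Let (Ω,P) be a probability space, let C : Ω → ℝ^d be measurable, and let (U, U_Y) : Ω → ℝ^m × ℝ have a centered multivariate Gaussian law on ℝ^{m+1} with Cov(U) = Σ_UU positive definite and σ_UY := (Cov(U_i, U_Y))_{i=1..m}, with C independent of (U, U_Y). Let a ∈ ℝ^s be a fixed intervention assignment, let f : ℝ^d → ℝ^m be measurable, set X := f(C) + U (the non-intervened treatments), and let f_Y : ℝ^d × ℝ^s × ℝ^m → ℝ be measurable with f_Y(C, a, X) integrable. Define the post-intervention outcome Y := f_Y(C, a, X) + U_Y. Then E[Y | σ(C, X)] = f_Y(C, a, X) + σ_UYᵀ Σ_UU^{-1} (X − f ∘ C) almost surely. (This is the outcome decomposition E[Y | C, do(X_int = a), X_obs] = f_Y(C, a, X_obs) + E[U_Y | X_obs − f(C)] used for inference under arbitrary sets of interventions in symmetric additive noise models.) -/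

import Mathlib

open MeasureTheory ProbabilityTheory Matrix

/-- The standard Gaussian product measure on `ℝ^n`. -/
noncomputable def stdGaussianPi (n : ℕ) : Measure (Fin n → ℝ) :=
  Measure.pi fun _ => gaussianReal 0 1

/-- `μ` is the centered multivariate Gaussian measure on `ℝ^n` with covariance matrix `S`. -/
def IsCenteredGaussian {n : ℕ} (μ : Measure (Fin n → ℝ))
    (S : Matrix (Fin n) (Fin n) ℝ) : Prop :=
  ∃ A : Matrix (Fin n) (Fin n) ℝ, S = A * Aᵀ ∧ μ = (stdGaussianPi n).map A.mulVec

lemma map_eval_stdGaussianPi {n : ℕ} (i : Fin n) :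
    (stdGaussianPi n).map (fun x => x i) = gaussianReal 0 1 :=
  (measurePreserving_eval (fun _ : Fin n => gaussianReal 0 1) i).map_eq

lemma iIndepFun_eval_stdGaussianPi (n : ℕ) :
    iIndepFun (fun i (x : Fin n → ℝ) => x i) (stdGaussianPi n) :=
  iIndepFun_pi (X := fun _ => id) fun _ => aemeasurable_id

lemma hasGaussianLaw_eval_stdGaussianPi (n : ℕ) :
    HasGaussianLaw (fun (x : Fin n → ℝ) i => x i) (stdGaussianPi n) :=
  (iIndepFun_eval_stdGaussianPi n).hasGaussianLaw
    fun i => ⟨by rw [map_eval_stdGaussianPi]; infer_instance⟩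

lemma integral_eval_stdGaussianPi {n : ℕ} (i : Fin n) : ∫ x, x i ∂stdGaussianPi n = 0 := by
  have h := integral_map (μ := stdGaussianPi n) (measurable_pi_apply i).aemeasurable
    measurable_id.aestronglyMeasurable (f := (id : ℝ → ℝ))
  rw [map_eval_stdGaussianPi] at h
  exact h.symm.trans integral_id_gaussianReal

lemma covariance_eval_stdGaussianPi {n : ℕ} (i j : Fin n) :
    cov[fun x => x i, fun x => x j; stdGaussianPi n] = (1 : Matrix (Fin n) (Fin n) ℝ) i j := by
  have hG := hasGaussianLaw_eval_stdGaussianPi n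
  by_cases hij : i = j
  · subst hij
    have h := variance_map (μ := stdGaussianPi n) (X := (id : ℝ → ℝ)) (Y := fun x => x i)
      measurable_id.aemeasurable (measurable_pi_apply i).aemeasurable
    rw [map_eval_stdGaussianPi, variance_id_gaussianReal] at h
    rw [covariance_self (measurable_pi_apply i).aemeasurable, Matrix.one_apply_eq]
    exact h.symm
  · rw [Matrix.one_apply_ne hij]
    exact ((iIndepFun_eval_stdGaussianPi n).indepFun hij).covariance_eq_zero
      (hG.eval i).memLp_two (hG.eval j).memLp_two

section IsCenteredGaussian

variable {n : ℕ} {μ : Measure (Fin n → ℝ)} {S : Matrix (Fin n) (Fin n) ℝ}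

lemma IsCenteredGaussian.isGaussian (h : IsCenteredGaussian μ S) : IsGaussian μ := by
  obtain ⟨A, -, rfl⟩ := h
  exact ((hasGaussianLaw_eval_stdGaussianPi n).map
    (LinearMap.toContinuousLinearMap A.mulVecLin)).isGaussian_map

lemma IsCenteredGaussian.integral_eval (h : IsCenteredGaussian μ S) (i : Fin n) :
    ∫ x, x i ∂μ = 0 := by
  obtain ⟨A, -, rfl⟩ := h
  have hG := hasGaussianLaw_eval_stdGaussianPi n
  have hA : Measurable A.mulVec := A.mulVecLin.toContinuousLinearMap.continuous.measurable
  rw [integral_map hA.aemeasurable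
    (measurable_pi_apply i).aestronglyMeasurable]
  simp only [mulVec, dotProduct]
  rw [integral_finsetSum _ fun k _ => (hG.eval k).integrable.const_mul _]
  simp [integral_const_mul, integral_eval_stdGaussianPi]

lemma IsCenteredGaussian.covariance_eval (h : IsCenteredGaussian μ S) (i j : Fin n) :
    cov[fun x => x i, fun x => x j; μ] = S i j := by
  obtain ⟨A, rfl, rfl⟩ := h
  have hG := hasGaussianLaw_eval_stdGaussianPi n
  have := hG.isProbabilityMeasure
  have hA : Measurable A.mulVec := A.mulVecLin.toContinuousLinearMap.continuous.measurable
  rw [covariance_map_fun (measurable_pi_apply i).aestronglyMeasurable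
    (measurable_pi_apply j).aestronglyMeasurable hA.aemeasurable]
  simp only [mulVec, dotProduct]
  rw [covariance_fun_sum_fun_sum (fun k => (hG.eval k).memLp_two.const_mul _)
    (fun k => (hG.eval k).memLp_two.const_mul _)]
  simp [covariance_const_mul_left, covariance_const_mul_right, covariance_eval_stdGaussianPi,
    Matrix.one_apply, Matrix.mul_apply, mul_comm]

end IsCenteredGaussian

lemma ProbabilityTheory.IndepFun.prodMk_left_of_prodMk_right {Ω α β γ : Type*}
    [MeasurableSpace Ω] [MeasurableSpace α] [MeasurableSpace β] [MeasurableSpace γ]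
    {P : Measure Ω} [IsProbabilityMeasure P] {X : Ω → α} {Y : Ω → β} {Z : Ω → γ}
    (hX : Measurable X) (hY : Measurable Y) (hZ : Measurable Z)
    (hXYZ : IndepFun X (fun ω => (Y ω, Z ω)) P) (hYZ : IndepFun Y Z P) :
    IndepFun (fun ω => (X ω, Y ω)) Z P := by
  have := Measure.isProbabilityMeasure_map (μ := P) hX.aemeasurable
  have := Measure.isProbabilityMeasure_map (μ := P) hY.aemeasurable
  have := Measure.isProbabilityMeasure_map (μ := P) hZ.aemeasurable
  have hXY : IndepFun X Y P := hXYZ.comp measurable_id measurable_fst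
  rw [indepFun_iff_map_prod_eq_prod_map_map (by fun_prop) (by fun_prop)] at hXYZ hYZ hXY ⊢
  rw [hYZ] at hXYZ
  have e := (measurePreserving_prodAssoc (P.map X) (P.map Y) (P.map Z)).symm.map_eq
  rw [hXY, ← e, ← hXYZ, Measure.map_map (by fun_prop) (by fun_prop)]
  rfl

/-- The outcome decomposition under an intervention `do(X_int = a)` in a symmetric
additive noise model: with `(U, U_Y)` centered multivariate Gaussian on `ℝ^{m+1}`,
`Cov(U) = Σ_UU` positive definite, `σ_UY = (Cov(U_i, U_Y))_i`, `C` independent of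
`(U, U_Y)`, non-intervened treatments `X = f(C) + U`, and post-intervention outcome
`Y = f_Y(C, a, X) + U_Y`, we have
`E[Y | σ(C, X)] = f_Y(C, a, X) + σ_UYᵀ Σ_UU⁻¹ (X − f(C))` a.s.
Index convention: `U` occupies indices `Fin.castSucc i`, `U_Y` the index `Fin.last m`. -/
theorem condexp_outcome_post_intervention
    {Ω : Type*} [MeasurableSpace Ω] (P : Measure Ω) [IsProbabilityMeasure P]
    (d m s : ℕ)
    (C : Ω → Fin d → ℝ) (hC : Measurable C)
    (N : Ω → Fin (m + 1) → ℝ) (hN : Measurable N)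
    (S : Matrix (Fin (m + 1)) (Fin (m + 1)) ℝ)
    (hlaw : IsCenteredGaussian (P.map N) S)
    (hpos : (S.submatrix (Fin.castSucc : Fin m → Fin (m + 1)) Fin.castSucc).PosDef)
    (hindep : IndepFun C N P)
    (a : Fin s → ℝ)
    (f : (Fin d → ℝ) → Fin m → ℝ) (hf : Measurable f)
    (X : Ω → Fin m → ℝ) (hX : X = fun ω i => f (C ω) i + N ω (Fin.castSucc i))
    (fY : (Fin d → ℝ) → (Fin s → ℝ) → (Fin m → ℝ) → ℝ)
    (hfY : Measurable fun p : (Fin d → ℝ) × (Fin s → ℝ) × (Fin m → ℝ) =>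
      fY p.1 p.2.1 p.2.2)
    (hfYint : Integrable (fun ω => fY (C ω) a (X ω)) P)
    (Y : Ω → ℝ) (hY : Y = fun ω => fY (C ω) a (X ω) + N ω (Fin.last m)) :
    P[Y | MeasurableSpace.comap (fun ω => (C ω, X ω)) inferInstance]
      =ᵐ[P] fun ω =>
        fY (C ω) a (X ω) +
          dotProduct (fun i : Fin m => S (Fin.castSucc i) (Fin.last m))
            ((S.submatrix (Fin.castSucc : Fin m → Fin (m + 1)) Fin.castSucc)⁻¹.mulVec
              (fun i => X ω i - f (C ω) i)) := by
  set T := S.submatrix (Fin.castSucc : Fin m → Fin (m + 1)) Fin.castSucc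
  set σ : Fin m → ℝ := fun i => S (Fin.castSucc i) (Fin.last m)
  set w : Fin m → ℝ := σ ᵥ* T⁻¹ with hw
  set V : Ω → ℝ := fun ω => N ω (Fin.last m) - ∑ j, w j * N ω (Fin.castSucc j) with hV
  have hXm : Measurable X := by rw [hX]; fun_prop
  have hVm : Measurable V := by fun_prop
  have hNG : HasGaussianLaw (fun ω i => N ω i) P := ⟨hlaw.isGaussian⟩
  have hcov (i j : Fin (m + 1)) : cov[fun ω => N ω i, fun ω => N ω j; P] = S i j := by
    rw [← hlaw.covariance_eval, covariance_map_fun (measurable_pi_apply i).aestronglyMeasurable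
      (measurable_pi_apply j).aestronglyMeasurable hN.aemeasurable]
  have hmean (i : Fin (m + 1)) : ∫ ω, N ω i ∂P = 0 := by
    rw [← hlaw.integral_eval i, integral_map hN.aemeasurable
      (measurable_pi_apply i).aestronglyMeasurable]
  have hUVlaw : HasGaussianLaw
      (fun ω => ((fun i : Fin m => N ω (Fin.castSucc i)), fun _ : Unit => V ω)) P := by
    let L : (Fin (m + 1) → ℝ) →ₗ[ℝ] (Fin m → ℝ) × (Unit → ℝ) :=
      (LinearMap.funLeft ℝ ℝ Fin.castSucc).prod
        (LinearMap.pi fun _ => LinearMap.proj (Fin.last m) -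
          ∑ j, w j • LinearMap.proj (Fin.castSucc j))
    refine (hNG.map_fun L.toContinuousLinearMap).congr (ae_of_all _ fun ω => ?_)
    refine Prod.ext rfl (funext fun _ => ?_)
    simp [L, hV]
  have hUV : IndepFun (fun ω (i : Fin m) => N ω (Fin.castSucc i)) V P := by
    refine (hUVlaw.indepFun_of_covariance_eval (X := fun i ω => N ω (Fin.castSucc i))
      (Y := fun _ => V) fun i _ => ?_).comp measurable_id (measurable_pi_apply ())
    have hwT : w ᵥ* T = σ := by
      rw [hw, vecMul_vecMul, nonsing_inv_mul _ hpos.det_pos.ne'.isUnit, vecMul_one]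
    have hsymm (j : Fin m) : S (Fin.castSucc i) (Fin.castSucc j) = T j i :=
      hpos.isHermitian.apply j i
    rw [hV, covariance_fun_sub_right (hNG.eval _).memLp_two (hNG.eval _).memLp_two
      (memLp_finsetSum _ fun j _ => (hNG.eval _).memLp_two.const_mul _),
      covariance_fun_sum_right (fun j => (hNG.eval _).memLp_two.const_mul _)
        (hNG.eval _).memLp_two]
    simp only [covariance_const_mul_right, hcov, hsymm]
    exact sub_eq_zero.2 (congrFun hwT i).symm
  have hCUV : IndepFun (fun ω => (C ω, fun i : Fin m => N ω (Fin.castSucc i))) V P := by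
    refine IndepFun.prodMk_left_of_prodMk_right hC (by fun_prop) hVm ?_ hUV
    exact hindep.comp measurable_id (ψ := fun x : Fin (m + 1) → ℝ =>
      ((fun i : Fin m => x (Fin.castSucc i)), x (Fin.last m) - ∑ j, w j * x (Fin.castSucc j)))
      (by fun_prop)
  have hCXV : IndepFun (fun ω => (C ω, X ω)) V P := by
    rw [hX]
    exact hCUV.comp (φ := fun p : (Fin d → ℝ) × (Fin m → ℝ) => (p.1, fun i => f p.1 i + p.2 i))
      (by fun_prop) measurable_id
  have hVint : Integrable V P := (hNG.eval _).integrable.sub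
    (integrable_finsetSum _ fun j _ => (hNG.eval _).integrable.const_mul _)
  have hVmean : ∫ ω, V ω ∂P = 0 := by
    rw [hV, integral_sub (hNG.eval _).integrable
      (integrable_finsetSum _ fun j _ => (hNG.eval _).integrable.const_mul _),
      integral_finsetSum _ fun j _ => (hNG.eval _).integrable.const_mul _]
    simp [integral_const_mul, hmean]
  set G : Ω → ℝ := fun ω => fY (C ω) a (X ω) + σ ⬝ᵥ (T⁻¹ *ᵥ fun i => X ω i - f (C ω) i) with hG
  have hlin (ω : Ω) : σ ⬝ᵥ (T⁻¹ *ᵥ fun i => X ω i - f (C ω) i) =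
      ∑ j, w j * N ω (Fin.castSucc j) := by
    rw [dotProduct_mulVec, hX]
    simp [dotProduct, hw]
  have hGint : Integrable G P := by
    simp only [hG, hlin]
    exact hfYint.add (integrable_finsetSum _ fun j _ => (hNG.eval _).integrable.const_mul _)
  have hle := (hC.prodMk hXm).comap_le
  have hGm : StronglyMeasurable[MeasurableSpace.comap (fun ω => (C ω, X ω)) inferInstance] G := by
    have hg : Measurable fun p : (Fin d → ℝ) × (Fin m → ℝ) =>
        fY p.1 a p.2 + σ ⬝ᵥ (T⁻¹ *ᵥ fun i => p.2 i - f p.1 i) := by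
      refine (hfY.comp (measurable_fst.prodMk (measurable_const.prodMk measurable_snd))).add ?_
      simp only [dotProduct]
      fun_prop
    exact (hg.comp (comap_measurable _)).stronglyMeasurable
  have hYGV : Y = G + V := by
    ext ω
    simp only [hY, hG, hV, hlin, Pi.add_apply]
    ring
  have hcondV := condExp_indep_eq hVm.comap_le hle
    (comap_measurable V).stronglyMeasurable hCXV.symm
  rw [hYGV]
  filter_upwards [condExp_add hGint hVint
    (MeasurableSpace.comap (fun ω => (C ω, X ω)) inferInstance), hcondV] with ω h₁ h₂
  rw [h₁, Pi.add_apply, h₂, hVmean, add_zero, condExp_of_stronglyMeasurable hle hGm hGint]
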